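/- Let (X,f) be a dynamical system which is uniquely ergodic, minimal, totally transitive but not topologically weakly mixing. Then for every m ≥ 2 there exists a non-uniform A ∈ C(X, GL(m,ℝ)). -/

import Mathlib

open MeasureTheory Filter Topology Set
open scoped ENNReal NNReal

attribute [local instance] Matrix.normedAddCommGroup

noncomputable section

/-- The cocycle `A(n,x) = A(f^{n-1}x) ⋯ A(fx) A(x)` generated by a matrix-valued map `A`. -/
def cocycle {X : Type*} {m : ℕ} (f : X → X) (A : X → Matrix (Fin m) (Fin m) ℝ) :
    ℕ → X → Matrix (Fin m) (Fin m) ℝ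
  | 0, _ => 1
  | n + 1, x => A (f^[n] x) * cocycle f A n x

/-- `A` is a uniform cocycle over `f` if `(1/n) log ‖A(n,x)‖` converges uniformly on `X`. -/
def IsUniformCocycle {X : Type*} [TopologicalSpace X] {m : ℕ} (f : X → X)
    (A : X → Matrix (Fin m) (Fin m) ℝ) : Prop :=
  ∃ L : X → ℝ, TendstoUniformly (fun (n : ℕ) (x : X) => Real.log ‖cocycle f A n x‖ / n) L atTop

/-- `A` is a continuous map from `X` to `GL(m,ℝ)`. -/
def ContGL {X : Type*} [TopologicalSpace X] {m : ℕ} (A : X → Matrix (Fin m) (Fin m) ℝ) : Prop :=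
  Continuous A ∧ ∀ x, IsUnit (A x)

/-- `μ` is an `f`-invariant Borel probability measure. -/
def InvProb {X : Type*} [MeasurableSpace X] (f : X → X) (μ : Measure X) : Prop :=
  IsProbabilityMeasure μ ∧ μ.map f = μ

/-- `f` is uniquely ergodic: it has exactly one invariant Borel probability measure. -/
def UniquelyErgodic {X : Type*} [MeasurableSpace X] (f : X → X) : Prop :=
  ∃! μ : Measure X, InvProb f μ

/-- `f` is uniquely ergodic with unique invariant Borel probability measure `μ`. -/
def UniquelyErgodicWith {X : Type*} [MeasurableSpace X] (f : X → X) (μ : Measure X) : Prop :=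
  InvProb f μ ∧ ∀ ν : Measure X, InvProb f ν → ν = μ

/-- `f` is totally uniquely ergodic: every positive power of `f` is uniquely ergodic. -/
def TotallyUniquelyErgodic {X : Type*} [MeasurableSpace X] (f : X → X) : Prop :=
  ∀ n : ℕ, 0 < n → UniquelyErgodic (f^[n])

/-- Topological transitivity. -/
def TopTransitive {X : Type*} [TopologicalSpace X] (f : X → X) : Prop :=
  ∀ U V : Set X, IsOpen U → IsOpen V → U.Nonempty → V.Nonempty →
    ∃ k : ℕ, 0 < k ∧ (f^[k] '' U ∩ V).Nonempty

/-- Total transitivity: every positive power is topologically transitive. -/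
def TotallyTransitive {X : Type*} [TopologicalSpace X] (f : X → X) : Prop :=
  ∀ n : ℕ, 0 < n → TopTransitive (f^[n])

/-- Topological weak mixing: `f × f` is topologically transitive. -/
def TopWeaklyMixing {X : Type*} [TopologicalSpace X] (f : X → X) : Prop :=
  TopTransitive (Prod.map f f)

/-- Topological mixing. -/
def TopMixing {X : Type*} [TopologicalSpace X] (f : X → X) : Prop :=
  ∀ U V : Set X, IsOpen U → IsOpen V → U.Nonempty → V.Nonempty →
    ∃ N : ℕ, 0 < N ∧ ∀ k ≥ N, (f^[k] '' U ∩ V).Nonempty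

/-- Minimality: every forward orbit is dense. -/
def MinimalSys {X : Type*} [TopologicalSpace X] (f : X → X) : Prop :=
  ∀ x : X, Dense (Set.range fun n : ℕ => f^[n] x)

open scoped InnerProductSpace
open ComplexConjugate

theorem isCompactOperator_rankOne {H : Type*} [NormedAddCommGroup H] [InnerProductSpace ℂ H]
    (u v : H) : IsCompactOperator (InnerProductSpace.rankOne ℂ u v) := by
  rw [InnerProductSpace.rankOne_def']
  exact (isCompactOperator_of_locallyCompactSpace_rng
    (ContinuousLinearMap.toSpanSingleton ℂ u)).comp_clm _

/-- A compact self-adjoint operator commuting with a linear isometry shares with it an eigenvector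
outside its kernel. -/
theorem exists_common_eigenvector {H : Type*} [NormedAddCommGroup H] [InnerProductSpace ℂ H]
    [CompleteSpace H] {S : H →L[ℂ] H} (hS : IsCompactOperator S)
    (hsymm : (S : H →ₗ[ℂ] H).IsSymmetric) (hS0 : S ≠ 0)
    (V : H →ₗᵢ[ℂ] H) (hVS : ∀ v, V (S v) = S (V v)) :
    ∃ v : H, S v ≠ 0 ∧ ∃ c : ℂ, ‖c‖ = 1 ∧ V v = c • v := by
  obtain ⟨l, hl, hl0⟩ : ∃ l, Module.End.HasEigenvalue (S : Module.End ℂ H) l ∧ l ≠ 0 := by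
    by_contra! h
    exact hS0 ((ContinuousLinearMap.eq_zero_of_forall_hasEigenvalue_eq_zero hS hsymm).1 h)
  set E := Module.End.eigenspace (S : Module.End ℂ H) l
  have : FiniteDimensional ℂ E := ContinuousLinearMap.finite_dimensional_eigenspace hS l hl0
  have : Nontrivial E := Submodule.nontrivial_iff_ne_bot.2 hl
  have hVE : ∀ v ∈ E, V.toLinearMap v ∈ E := fun v hv ↦ by
    rw [Module.End.mem_eigenspace_iff] at hv ⊢
    have hv' : S v = l • v := hv
    change S (V v) = l • V v
    rw [← hVS, hv', map_smul]
  obtain ⟨c, hc⟩ := Module.End.exists_eigenvalue (V.toLinearMap.restrict hVE)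
  obtain ⟨⟨v, hvE⟩, hv⟩ := hc.exists_hasEigenvector
  have hv0 : v ≠ 0 := fun h ↦ hv.2 (Subtype.ext h)
  have hVv : V v = c • v := congrArg Subtype.val hv.apply_eq_smul
  refine ⟨v, ?_, c, ?_, hVv⟩
  · have hv' : S v = l • v := Module.End.mem_eigenspace_iff.1 hvE
    rw [hv']
    exact smul_ne_zero hl0 hv0
  · have := V.norm_map v
    rw [hVv, norm_smul] at this
    exact mul_right_cancel₀ (norm_ne_zero_iff.2 hv0) (by rw [this, one_mul])

/-- A nonconstant continuous equivariant map from a measure-preserving system into a Hilbert space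
with an isometry yields a nonconstant continuous eigenfunction. -/
theorem exists_eigenfunction_of_equivariant {X : Type*} [MetricSpace X] [CompactSpace X]
    [MeasurableSpace X] [BorelSpace X] {μ : Measure X} [IsProbabilityMeasure μ]
    [μ.IsOpenPosMeasure] {H : Type*} [NormedAddCommGroup H] [InnerProductSpace ℂ H]
    [CompleteSpace H] {f : X → X} (hfe : MeasurableEmbedding f) (hμ : MeasurePreserving f μ μ)
    {φ : X → H} (hφ : Continuous φ) (V : H →ₗᵢ[ℂ] H) (hV : ∀ x, V (φ (f x)) = φ x)
    (hne : ∃ x y, φ x ≠ φ y) :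
    ∃ (g : X → ℂ) (ω : ℂ), Continuous g ∧ ‖ω‖ = 1 ∧ (∀ x, g (f x) = ω * g x) ∧
      ∃ x y, g x ≠ g y := by
  have hint : ∀ {E : Type _} [NormedAddCommGroup E] {h : X → E}, Continuous h → Integrable h μ :=
    fun hh ↦ hh.integrable_of_hasCompactSupport (HasCompactSupport.of_compactSpace _)
  have hcomp : ∀ {E : Type _} [NormedAddCommGroup E] [NormedSpace ℝ E] (h : X → E),
      ∫ x, h (f x) ∂μ = ∫ x, h x ∂μ := fun h ↦ hμ.integral_comp hfe h
  let ψ : X → H := fun x ↦ φ x - ∫ y, φ y ∂μ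
  have hψ : Continuous ψ := by fun_prop
  have hψ0 : ∫ x, ψ x ∂μ = 0 := by
    simp [ψ, integral_sub (hint hφ) (integrable_const _)]
  have hVψ : ∀ x, V (ψ (f x)) = ψ x := fun x ↦ by
    simp only [ψ, map_sub, hV, ← V.integral_comp_comm]
    congr 1
    rw [← hcomp]
    simp [hV]
  let T : X → H →L[ℂ] H := fun x ↦ InnerProductSpace.rankOne ℂ (ψ x) (ψ x)
  have hT : Continuous T := by
    exact ((ContinuousLinearMap.smulRightL ℂ H H).continuous.comp
      ((innerSL ℂ).continuous.comp hψ)).clm_apply hψ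
  let S : H →L[ℂ] H := ∫ x, T x ∂μ
  have hSv : ∀ v, S v = ∫ x, ⟪ψ x, v⟫_ℂ • ψ x ∂μ := fun v ↦ by
    simp only [S]
    rw [ContinuousLinearMap.integral_apply (hint hT)]
    rfl
  have hinner : ∀ v w, ⟪w, S v⟫_ℂ = ∫ x, ⟪ψ x, v⟫_ℂ * ⟪w, ψ x⟫_ℂ ∂μ := fun v w ↦ by
    rw [hSv, ← integral_inner (hint (by fun_prop))]
    simp [inner_smul_right]
  have hSc : IsCompactOperator S := by
    have hconv : Convex ℝ {T : H →L[ℂ] H | IsCompactOperator T} := by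
      intro A hA B hB a b _ _ _
      exact IsCompactOperator.add (hA.smul a) (hB.smul b)
    exact hconv.integral_mem isClosed_setOfPred_isCompactOperator
      (Eventually.of_forall fun x ↦ isCompactOperator_rankOne _ _) (hint hT)
  have hsymm : (S : H →ₗ[ℂ] H).IsSymmetric := fun v w ↦ by
    change ⟪S v, w⟫_ℂ = ⟪v, S w⟫_ℂ
    rw [← inner_conj_symm, hinner, hinner, ← integral_conj]
    congr 1 with x
    rw [map_mul, inner_conj_symm, inner_conj_symm, mul_comm]
  have hS0 : S ≠ 0 := by
    intro h
    have hz : ∀ v x, ⟪ψ x, v⟫_ℂ = 0 := fun v ↦ by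
      have h1 : ∫ x, ‖⟪ψ x, v⟫_ℂ‖ ^ 2 ∂μ = 0 := by
        have := hinner v v
        rw [h, zero_apply, inner_zero_right] at this
        rw [← Complex.ofReal_inj, ← integral_complex_ofReal, Complex.ofReal_zero, this]
        congr 1 with x
        rw [← inner_conj_symm v, Complex.mul_conj, Complex.normSq_eq_norm_sq]
      have hc : Continuous fun x ↦ ‖⟪ψ x, v⟫_ℂ‖ ^ 2 := by fun_prop
      rw [integral_eq_zero_iff_of_nonneg (fun x ↦ by positivity)
          (hc.integrable_of_hasCompactSupport (HasCompactSupport.of_compactSpace _))] at h1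
      have h2 := (Continuous.ae_eq_iff_eq μ hc continuous_zero).1 h1
      intro x
      simpa using congrFun h2 x
    obtain ⟨x, y, hxy⟩ := hne
    have hx := inner_self_eq_zero.1 (hz (ψ x) x)
    have hy := inner_self_eq_zero.1 (hz (ψ y) y)
    exact hxy (by rw [sub_eq_zero.1 hx, sub_eq_zero.1 hy])
  have hVS : ∀ v, V (S v) = S (V v) := fun v ↦ by
    rw [hSv, hSv, ← hcomp, ← V.integral_comp_comm]
    congr 1 with x
    rw [map_smul, hVψ, ← V.inner_map_map, hVψ]
  obtain ⟨v, hv, c, hc, hVv⟩ := exists_common_eigenvector hSc hsymm hS0 V hVS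
  refine ⟨fun x ↦ ⟪v, ψ x⟫_ℂ, starRingEnd ℂ c, by fun_prop, by simpa using hc, fun x ↦ ?_, ?_⟩
  · change ⟪v, ψ (f x)⟫_ℂ = _
    rw [← V.inner_map_map, hVψ, hVv, inner_smul_left]
  · by_contra! hconst
    have hzero : ∀ x, ⟪v, ψ x⟫_ℂ = 0 := fun x ↦ by
      have h1 : ∫ y, ⟪v, ψ y⟫_ℂ ∂μ = 0 := by
        rw [integral_inner (hint hψ), hψ0, inner_zero_right]
      simpa [hconst _ x] using h1
    refine hv ?_
    rw [hSv]
    simp [inner_eq_zero_symm.1 (hzero _)]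

/-- The pair `(pₙ(z), qₙ(z))` such that, for `‖z‖ = ‖ω‖ = 1`, the `n`-th iterate over the rotation
`z ↦ ω z` of the cocycle `diag(2, 1/2) * rotation` is the real-linear map `w ↦ pₙ w + qₙ (conj w)`. -/
def rotCoeff (ω : ℂ) : ℕ → ℂ → ℂ × ℂ
  | 0, _ => (1, 0)
  | n + 1, z =>
    (5 / 4 * (ω ^ n * z) * (rotCoeff ω n z).1 +
        3 / 4 * conj (ω ^ n * z) * conj (rotCoeff ω n z).2,
      5 / 4 * (ω ^ n * z) * (rotCoeff ω n z).2 +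
        3 / 4 * conj (ω ^ n * z) * conj (rotCoeff ω n z).1)

theorem rotCoeff_succ' (ω : ℂ) (n : ℕ) (z : ℂ) :
    rotCoeff ω (n + 1) z =
      (z * (5 / 4 * (rotCoeff ω n (ω * z)).1 + 3 / 4 * (rotCoeff ω n (ω * z)).2),
        conj z * (3 / 4 * (rotCoeff ω n (ω * z)).1 + 5 / 4 * (rotCoeff ω n (ω * z)).2)) := by
  induction n with
  | zero => simp [rotCoeff]; constructor <;> ring
  | succ n ih =>
    rw [rotCoeff, ih, rotCoeff]
    have h54 : conj (5 / 4 : ℂ) = 5 / 4 := by simp [map_ofNat]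
    have h34 : conj (3 / 4 : ℂ) = 3 / 4 := by simp [map_ofNat]
    simp only [map_mul, map_add, map_pow, Complex.conj_conj, h54, h34]
    ext1 <;> dsimp only <;> ring

theorem continuous_rotCoeff (ω : ℂ) (n : ℕ) : Continuous (rotCoeff ω n) := by
  induction n with
  | zero => exact continuous_const
  | succ n ih => simp only [funext fun z ↦ rotCoeff.eq_2 ω z n]; fun_prop

theorem mul_conj_eq_one {z : ℂ} (hz : ‖z‖ = 1) : z * conj z = 1 := by
  simp [Complex.mul_conj, Complex.normSq_eq_norm_sq, hz]

theorem normSq_rotCoeff {ω : ℂ} (hω : ‖ω‖ = 1) (n : ℕ) {z : ℂ} (hz : ‖z‖ = 1) :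
    ‖(rotCoeff ω n z).1‖ ^ 2 - ‖(rotCoeff ω n z).2‖ ^ 2 = 1 := by
  induction n with
  | zero => simp [rotCoeff]
  | succ n ih =>
    have hy : ‖ω ^ n * z‖ = 1 := by simp [hω, hz]
    have key : ∀ y p q : ℂ, ‖y‖ = 1 → ‖5 / 4 * y * p + 3 / 4 * conj y * conj q‖ ^ 2 -
        ‖5 / 4 * y * q + 3 / 4 * conj y * conj p‖ ^ 2 = ‖p‖ ^ 2 - ‖q‖ ^ 2 := by
      intro y p q hy
      have hy' := mul_conj_eq_one hy
      have h54 : conj (5 / 4 : ℂ) = 5 / 4 := by simp [map_ofNat]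
      have h34 : conj (3 / 4 : ℂ) = 3 / 4 := by simp [map_ofNat]
      have : ∀ w : ℂ, ((‖w‖ ^ 2 : ℝ) : ℂ) = w * conj w := fun w ↦ by
        rw [Complex.mul_conj, Complex.normSq_eq_norm_sq]
      rw [← Complex.ofReal_inj, Complex.ofReal_sub, Complex.ofReal_sub]
      simp only [this, map_mul, map_add, Complex.conj_conj, h54, h34]
      linear_combination (p * conj p - q * conj q) * hy'
    rw [rotCoeff]
    exact (key _ _ _ hy).trans ih

/-- Subharmonicity lower bound: on the unit circle `pₙ(z) = zⁿ U(conj z)` with `U` entire and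
`‖U 0‖ = (5/4)ⁿ`. -/
theorem pow_le_of_norm_rotCoeff_le {ω : ℂ} (hω : ‖ω‖ = 1) (n : ℕ) {C : ℝ}
    (hC : ∀ z : ℂ, ‖z‖ = 1 → ‖(rotCoeff ω n z).1‖ ≤ C) : (5 / 4 : ℝ) ^ n ≤ C := by
  obtain ⟨U, V, hU, -, hU0, hUV⟩ : ∃ U V : ℂ → ℂ, Differentiable ℂ U ∧ Differentiable ℂ V ∧
      ‖U 0‖ = (5 / 4 : ℝ) ^ n ∧ ∀ z : ℂ, ‖z‖ = 1 →
        (rotCoeff ω n z).1 = z ^ n * U (conj z) ∧ conj (rotCoeff ω n z).2 = z ^ n * V (conj z) := by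
    clear hC
    induction n with
    | zero => exact ⟨fun _ ↦ 1, fun _ ↦ 0, by fun_prop, by fun_prop, by simp, by simp [rotCoeff]⟩
    | succ n ih =>
      obtain ⟨U, V, hU, hV, hU0, hUV⟩ := ih
      refine ⟨fun b ↦ 5 / 4 * ω ^ n * U b + 3 / 4 * conj (ω ^ n) * b ^ 2 * V b,
        fun b ↦ 5 / 4 * conj (ω ^ n) * b ^ 2 * V b + 3 / 4 * ω ^ n * U b,
        by fun_prop, by fun_prop, ?_, fun z hz ↦ ?_⟩
      · simp [hU0, hω, pow_succ, mul_comm]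
      · obtain ⟨h1, h2⟩ := hUV z hz
        have hzz := mul_conj_eq_one hz
        have h54 : conj (5 / 4 : ℂ) = 5 / 4 := by simp [map_ofNat]
        have h34 : conj (3 / 4 : ℂ) = 3 / 4 := by simp [map_ofNat]
        rw [rotCoeff]
        simp only [map_mul, map_add, Complex.conj_conj, h54, h34, h2, h1]
        constructor
        · linear_combination (-3 / 4 * conj (ω ^ n) * conj z * z ^ n * V (conj z)) * hzz
        · linear_combination (-5 / 4 * conj (ω ^ n) * conj z * z ^ n * V (conj z)) * hzz
  rw [← hU0]
  refine Complex.norm_le_of_forall_mem_frontier_norm_le (U := Metric.ball (0 : ℂ) 1)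
    Metric.isBounded_ball hU.diffContOnCl (fun b hb ↦ ?_) (subset_closure (by simp))
  rw [frontier_ball _ one_ne_zero, mem_sphere_zero_iff_norm] at hb
  have hb' : ‖conj b‖ = 1 := by simpa using hb
  have := hC _ hb'
  rwa [(hUV _ hb').1, Complex.conj_conj, norm_mul, norm_pow, hb', one_pow, one_mul] at this

/-- A continuous logarithm of `1` is constant. -/
theorem eq_of_continuous_of_exp_eq_one {G : ℝ → ℂ} (hG : Continuous G)
    (h : ∀ x, Complex.exp (G x) = 1) (x y : ℝ) : G x = G y := by
  refine IsLocallyConstant.apply_eq_of_preconnectedSpace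
    ((IsLocallyConstant.iff_eventually_eq _).2 fun x ↦ ?_) x y
  filter_upwards [Metric.continuous_iff'.1 hG x 1 one_pos] with y hy
  obtain ⟨k, hk⟩ := Complex.exp_eq_one_iff.1
    (show Complex.exp (G y - G x) = 1 by rw [Complex.exp_sub, h, h, div_one])
  rw [dist_eq_norm, hk, norm_mul, Complex.norm_intCast] at hy
  have h2 : ‖(2 * Real.pi * Complex.I : ℂ)‖ = 2 * Real.pi := by
    simp [abs_of_pos Real.pi_pos]
  rw [h2] at hy
  have hk0 : k = 0 := by
    by_contra hk0
    have : (1 : ℝ) ≤ |(k : ℝ)| := by exact_mod_cast Int.one_le_abs hk0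
    nlinarith [Real.pi_gt_three]
  rw [← sub_eq_zero, hk, hk0]; simp

/-- The topological obstruction: the norms of the iterates cannot be large everywhere. -/
theorem exists_norm_rotCoeff_le {ω : ℂ} (hω : ‖ω‖ = 1) (n : ℕ) :
    ∃ z : ℂ, ‖z‖ = 1 ∧ ‖(rotCoeff ω n z).1‖ ≤ 5 / 4 := by
  by_contra! hbig
  set P : ℂ → ℂ := fun z ↦ (rotCoeff ω n z).1 with hP
  set Q : ℂ → ℂ := fun z ↦ (rotCoeff ω n z).2 with hQ
  have hPc : Continuous P := (continuous_rotCoeff ω n).fst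
  have hQc : Continuous Q := (continuous_rotCoeff ω n).snd
  have hPQ : ∀ z, ‖z‖ = 1 → 3 / 4 * ‖P z‖ < 5 / 4 * ‖Q z‖ := fun z hz ↦ by
    have h1 := hbig z hz
    have h2 := normSq_rotCoeff hω n hz
    refine lt_of_pow_lt_pow_left₀ 2 (by positivity) ?_
    simp only [hP, hQ]
    nlinarith
  have hQ0 : ∀ z, ‖z‖ = 1 → Q z ≠ 0 := fun z hz h ↦ by
    have := hPQ z hz
    rw [h, norm_zero] at this
    linarith [norm_nonneg (P z)]
  set a : ℝ := ω.arg
  have hωa : ω = Complex.exp (a * Complex.I) := by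
    conv_lhs => rw [← Complex.norm_mul_exp_arg_mul_I ω, hω]
    simp [a]
  let e : ℝ → ℂ := fun x ↦ Complex.exp (x * Complex.I)
  have hec : Continuous e := by fun_prop
  have he : ∀ x, ‖e x‖ = 1 := fun x ↦ Complex.norm_exp_ofReal_mul_I x
  have he0 : ∀ x, e x ≠ 0 := fun x ↦ Complex.exp_ne_zero _
  have hadd : ∀ x, ω * e x = e (x + a) := fun x ↦ by
    simp only [e, hωa, ← Complex.exp_add]; congr 1; push_cast; ring
  have hper : ∀ x, e (x + 2 * Real.pi) = e x := fun x ↦ by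
    simp only [e]; push_cast; rw [add_mul, Complex.exp_add, Complex.exp_two_pi_mul_I, mul_one]
  obtain ⟨H, hHc, hH⟩ : ∃ H : ℝ → ℂ, Continuous H ∧ ∀ x, Complex.exp (H x) = Q (e x) := by
    have hs : IsSimplyConnected (Set.univ : Set ℝ) := by
      have : ContractibleSpace (Set.univ : Set ℝ) :=
        convex_univ.contractibleSpace Set.univ_nonempty
      exact SimplyConnectedSpace.ofContractible _
    obtain ⟨H, hH1, hH2⟩ := Complex.exists_continuousOn_eqOn_exp_comp hs isOpen_univ
      (g := fun x ↦ Q (e x)) (by fun_prop) (by simpa using fun x ↦ hQ0 _ (he x))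
    exact ⟨H, continuousOn_univ.1 hH1, fun x ↦ hH2 (Set.mem_univ x)⟩
  let ε₁ : ℝ → ℂ := fun x ↦ 3 / 4 * conj (ω ^ n * e x) * conj (P (e x)) /
    (5 / 4 * (ω ^ n * e x) * Q (e x))
  let ε₂ : ℝ → ℂ := fun x ↦ 3 / 4 * P (e (x + a)) / (5 / 4 * Q (e (x + a)))
  have hω0 : ω ^ n ≠ 0 := pow_ne_zero _ (by rw [hωa]; exact Complex.exp_ne_zero _)
  have hε₁c : Continuous ε₁ := by
    refine Continuous.div (by fun_prop) (by fun_prop) fun x ↦ ?_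
    have := he0 x; have := hQ0 _ (he x); simp_all
  have hε₂c : Continuous ε₂ := by
    refine Continuous.div (by fun_prop) (by fun_prop) fun x ↦ ?_
    have := hQ0 _ (he (x + a)); simp_all
  have hε₁ : ∀ x, ‖ε₁ x‖ < 1 := fun x ↦ by
    have h1 := hPQ _ (he x)
    have h2 : 0 < ‖Q (e x)‖ := norm_pos_iff.2 (hQ0 _ (he x))
    simp only [ε₁, norm_div, norm_mul, norm_pow, hω, he, Complex.norm_conj]
    norm_num
    rw [div_lt_one (by positivity)]
    linarith
  have hε₂ : ∀ x, ‖ε₂ x‖ < 1 := fun x ↦ by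
    have h1 := hPQ _ (he (x + a))
    have h2 : 0 < ‖Q (e (x + a))‖ := norm_pos_iff.2 (hQ0 _ (he _))
    simp only [ε₂, norm_div, norm_mul]
    norm_num
    rw [div_lt_one (by positivity)]
    linarith
  have hslit : ∀ w : ℂ, ‖w‖ < 1 → 1 + w ∈ Complex.slitPlane := fun w hw ↦
    Complex.mem_slitPlane_of_norm_lt_one hw
  let G : ℝ → ℂ := fun x ↦ 2 * (x * Complex.I) + n * (a * Complex.I) + H x - H (x + a) +
    Complex.log (1 + ε₁ x) - Complex.log (1 + ε₂ x)
  have hGc : Continuous G := by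
    have h1 : Continuous fun x ↦ Complex.log (1 + ε₁ x) :=
      Continuous.clog (by fun_prop) fun x ↦ hslit _ (hε₁ x)
    have h2 : Continuous fun x ↦ Complex.log (1 + ε₂ x) :=
      Continuous.clog (by fun_prop) fun x ↦ hslit _ (hε₂ x)
    fun_prop
  have hG : ∀ x, Complex.exp (G x) = 1 := fun x ↦ by
    have h1 : 1 + ε₁ x ≠ 0 := Complex.slitPlane_ne_zero (hslit _ (hε₁ x))
    have h2 : 1 + ε₂ x ≠ 0 := Complex.slitPlane_ne_zero (hslit _ (hε₂ x))
    have hq1 := hQ0 _ (he x)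
    have hq2 := hQ0 _ (he (x + a))
    have hx0 := he0 x
    have hωn : Complex.exp (n * (a * Complex.I)) = ω ^ n := by rw [Complex.exp_nat_mul, hωa]
    have hx2 : Complex.exp (2 * (x * Complex.I)) = e x ^ 2 := by
      rw [← Complex.exp_nat_mul]; norm_num
    have hrec : 5 / 4 * (ω ^ n * e x) * Q (e x) * (1 + ε₁ x) =
        conj (e x) * (5 / 4 * Q (e (x + a)) * (1 + ε₂ x)) := by
      have e1 : 5 / 4 * (ω ^ n * e x) * Q (e x) * (1 + ε₁ x) = (rotCoeff ω (n + 1) (e x)).2 := by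
        simp only [ε₁, rotCoeff]; field_simp; rfl
      have e2 : conj (e x) * (5 / 4 * Q (e (x + a)) * (1 + ε₂ x)) =
          (rotCoeff ω (n + 1) (e x)).2 := by
        rw [rotCoeff_succ', hadd]
        simp only [ε₂]; field_simp; simp only [hP, hQ]; ring
      rw [e1, e2]
    have hxx := mul_conj_eq_one (he x)
    simp only [G]
    rw [Complex.exp_sub, Complex.exp_add, Complex.exp_sub, Complex.exp_add, Complex.exp_add,
      Complex.exp_log h1, Complex.exp_log h2, hH, hH, hωn, hx2]
    rw [div_eq_one_iff_eq h2, div_mul_eq_mul_div, div_eq_iff hq2]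
    linear_combination (4 / 5 * e x) * hrec + (Q (e (x + a)) * (1 + ε₂ x)) * hxx
  have hHper : H 0 - H (0 + 2 * Real.pi) = H a - H (a + 2 * Real.pi) :=
    eq_of_continuous_of_exp_eq_one (G := fun x ↦ H x - H (x + 2 * Real.pi)) (by fun_prop)
      (fun x ↦ by rw [Complex.exp_sub, hH, hH, hper, div_self (hQ0 _ (he x))]) 0 a
  have hG2 := eq_of_continuous_of_exp_eq_one hGc hG 0 (2 * Real.pi)
  have hper0 : e (2 * Real.pi) = e 0 := by rw [← hper 0, zero_add]
  have e1 : ε₁ (2 * Real.pi) = ε₁ 0 := by simp only [ε₁, hper0]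
  have e2 : ε₂ (2 * Real.pi) = ε₂ 0 := by
    simp only [ε₂, add_comm _ a, hper, add_zero]
  simp only [G, e1, e2, zero_add, add_zero, add_comm _ a] at hG2 hHper
  have : (4 * Real.pi * Complex.I : ℂ) = 0 := by
    push_cast at hG2
    linear_combination -hG2 + hHper
  simp [Real.pi_ne_zero] at this

theorem IsOpenMap.iterate {X : Type*} [TopologicalSpace X] {f : X → X} (hf : IsOpenMap f) (n : ℕ) :
    IsOpenMap f^[n] := by
  induction n with
  | zero => exact IsOpenMap.id
  | succ n ih => exact ih.comp hf

namespace MinimalSys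

theorem eq_univ_of_isClosed {X : Type*} [TopologicalSpace X] {f : X → X} (hmin : MinimalSys f)
    {C : Set X} (hC : IsClosed C) (hne : C.Nonempty) (hfC : MapsTo f C C) : C = univ := by
  obtain ⟨x, hx⟩ := hne
  refine eq_univ_of_univ_subset ?_
  rw [← (hmin x).closure_eq]
  exact closure_minimal (range_subset_iff.2 fun n ↦ hfC.iterate n hx) hC

theorem apply_eq_of_comp_eq {X Y : Type*} [TopologicalSpace X] [TopologicalSpace Y] [T2Space Y]
    {f : X → X} (hmin : MinimalSys f) {h : X → Y} (hh : Continuous h) (hfh : ∀ x, h (f x) = h x)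
    (x y : X) : h x = h y := by
  have := hmin.eq_univ_of_isClosed (isClosed_eq hh (continuous_const (y := h y))) ⟨y, rfl⟩
    fun z (hz : h z = h y) ↦ (hfh z).trans hz
  exact eq_univ_iff_forall.1 this x

theorem isOpenPosMeasure {X : Type*} [TopologicalSpace X] [MeasurableSpace X] [BorelSpace X]
    {f : X → X} (hmin : MinimalSys f) {μ : Measure X} [NeZero μ] (hμ : MeasurePreserving f μ μ) :
    μ.IsOpenPosMeasure := by
  refine ⟨fun U hU hne h0 ↦ NeZero.ne μ (Measure.measure_univ_eq_zero.1 ?_)⟩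
  have hcov : (univ : Set X) ⊆ ⋃ n : ℕ, f^[n] ⁻¹' U := fun x _ ↦ by
    obtain ⟨_, hy, n, rfl⟩ := (hmin x).inter_open_nonempty U hU hne
    exact mem_iUnion.2 ⟨n, hy⟩
  refine measure_mono_null hcov (measure_iUnion_null fun n ↦ ?_)
  rw [(hμ.iterate n).measure_preimage hU.measurableSet.nullMeasurableSet, h0]

end MinimalSys

/-- The sections of a closed subset of a product with compact second factor are upper
semicontinuous. -/
theorem IsClosed.eventually_section_subset {X Y : Type*} [TopologicalSpace X] [TopologicalSpace Y]
    [CompactSpace Y] {N : Set (X × Y)} (hN : IsClosed N) {x : X} {G : Set Y} (hG : IsOpen G)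
    (hNG : Prod.mk x ⁻¹' N ⊆ G) : ∀ᶠ x' in 𝓝 x, Prod.mk x' ⁻¹' N ⊆ G := by
  have hcl : IsClosed (Prod.fst '' (N ∩ Prod.snd ⁻¹' Gᶜ)) :=
    isClosedMap_fst_of_compactSpace _ (hN.inter (hG.isClosed_compl.preimage continuous_snd))
  have hx : x ∈ (Prod.fst '' (N ∩ Prod.snd ⁻¹' Gᶜ))ᶜ := by
    rintro ⟨⟨_, y⟩, ⟨h1, h2⟩, rfl⟩
    exact h2 (hNG h1)
  filter_upwards [hcl.isOpen_compl.mem_nhds hx] with x' hx' y hy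
  by_contra hyG
  exact hx' ⟨(x', y), ⟨hy, hyG⟩, rfl⟩

section ClosedInvariant

variable {X : Type*} [MetricSpace X] [CompactSpace X] [MeasurableSpace X] [BorelSpace X]
  {μ : Measure X} [IsProbabilityMeasure μ] {f : X → X} {N : Set (X × X)}

/-- For a forward invariant closed set over a minimal system, all sections have the same
measure. -/
theorem measure_section_eq (hmin : MinimalSys f) (hμ : MeasurePreserving f μ μ) (hN : IsClosed N)
    (hfN : ∀ x y, (x, y) ∈ N → (f x, f y) ∈ N) (x x' : X) :
    μ (Prod.mk x ⁻¹' N) = μ (Prod.mk x' ⁻¹' N) := by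
  suffices h : ∀ x x', μ (Prod.mk x ⁻¹' N) ≤ μ (Prod.mk x' ⁻¹' N) from
    le_antisymm (h x x') (h x' x)
  intro x x'
  have hmeas : ∀ x, MeasurableSet (Prod.mk x ⁻¹' N) := fun x ↦
    (hN.preimage (Continuous.prodMk_right x)).measurableSet
  have hcl : IsClosed {z | μ (Prod.mk x ⁻¹' N) ≤ μ (Prod.mk z ⁻¹' N)} := by
    rw [← isOpen_compl_iff, isOpen_iff_mem_nhds]
    intro z hz
    obtain ⟨G, hGN, hG, hGlt⟩ := Set.exists_isOpen_lt_of_lt _ _ (not_le.1 hz)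
    filter_upwards [hN.eventually_section_subset hG hGN] with w hw
    exact not_le.2 ((measure_mono hw).trans_lt hGlt)
  refine eq_univ_iff_forall.1 (hmin.eq_univ_of_isClosed hcl ⟨x, le_refl (μ _)⟩
    fun z (hz : μ _ ≤ μ _) ↦ ?_) x'
  refine hz.trans ?_
  rw [← hμ.measure_preimage (hmeas (f z)).nullMeasurableSet]
  exact measure_mono fun y hy ↦ hfN z y hy

theorem tendsto_measure_section_symmDiff (hmin : MinimalSys f) (hμ : MeasurePreserving f μ μ)
    (hN : IsClosed N) (hfN : ∀ x y, (x, y) ∈ N → (f x, f y) ∈ N) (x : X) :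
    Tendsto (fun y ↦ μ (symmDiff (Prod.mk y ⁻¹' N) (Prod.mk x ⁻¹' N))) (𝓝 x) (𝓝 0) := by
  have hmeas : ∀ x, MeasurableSet (Prod.mk x ⁻¹' N) := fun x ↦
    (hN.preimage (Continuous.prodMk_right x)).measurableSet
  rw [ENNReal.tendsto_nhds_zero]
  intro ε hε
  have hε2 : ε / 2 ≠ 0 := (ENNReal.half_pos hε.ne').ne'
  obtain ⟨G, hGN, hG, hGlt⟩ := Set.exists_isOpen_lt_add (μ := μ) (Prod.mk x ⁻¹' N)
    (measure_ne_top _ _) hε2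
  have key : ∀ y, Prod.mk y ⁻¹' N ⊆ G → μ (G \ Prod.mk y ⁻¹' N) ≤ ε / 2 := fun y hy ↦ by
    rw [measure_sdiff hy (hmeas y).nullMeasurableSet (measure_ne_top _ _),
      measure_section_eq hmin hμ hN hfN y x]
    exact tsub_le_iff_left.2 hGlt.le
  filter_upwards [hN.eventually_section_subset hG hGN] with y hy
  calc μ (symmDiff (Prod.mk y ⁻¹' N) (Prod.mk x ⁻¹' N))
      ≤ μ (G \ Prod.mk x ⁻¹' N) + μ (G \ Prod.mk y ⁻¹' N) :=
        (measure_union_le _ _).trans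
          (add_le_add (measure_mono (sdiff_subset_sdiff_left hy))
            (measure_mono (sdiff_subset_sdiff_left hGN)))
    _ ≤ ε / 2 + ε / 2 := add_le_add (key x hGN) (key y hy)
    _ = ε := ENNReal.add_halves ε

end ClosedInvariant

/-- A minimal transitive system that is not weakly mixing and preserves a probability measure has a
nonconstant continuous equivariant map into `L²`. -/
theorem exists_equivariant_of_not_topWeaklyMixing {X : Type*} [MetricSpace X] [CompactSpace X]
    [MeasurableSpace X] [BorelSpace X] {μ : Measure X} [IsProbabilityMeasure μ]
    {f : X → X} (hf : IsHomeomorph f) (hμ : MeasurePreserving f μ μ) (hmin : MinimalSys f)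
    (htt : TopTransitive f) (hwm : ¬ TopWeaklyMixing f) :
    ∃ φ : X → Lp ℂ 2 μ, Continuous φ ∧
      (∀ x, Lp.compMeasurePreservingₗᵢ ℂ f hμ (φ (f x)) = φ x) ∧ ∃ x y, φ x ≠ φ y := by
  have := hmin.isOpenPosMeasure hμ
  simp only [TopWeaklyMixing, TopTransitive] at hwm
  push Not at hwm
  obtain ⟨U, V, hU, hV, hUne, ⟨⟨v₁, v₂⟩, hv⟩, hUV⟩ := hwm
  have hF : IsOpenMap (Prod.map f f) := hf.isOpenMap.prodMap hf.isOpenMap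
  have hFc : Continuous (Prod.map f f) := hf.continuous.prodMap hf.continuous
  let O : Set (X × X) := ⋃ k : ℕ, (Prod.map f f)^[k + 1] '' U
  have hOo : IsOpen O := isOpen_iUnion fun k ↦ hF.iterate (k + 1) U hU
  have hOF : MapsTo (Prod.map f f) O O := by
    intro z hz
    obtain ⟨k, u, hu, rfl⟩ := mem_iUnion.1 hz
    exact mem_iUnion.2 ⟨k + 1, u, hu, Function.iterate_succ_apply' _ _ _⟩
  let N := closure O
  have hN : IsClosed N := isClosed_closure
  have hfN : ∀ x y, (x, y) ∈ N → (f x, f y) ∈ N := fun x y h ↦ hOF.closure hFc h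
  have hNV : Disjoint N V := by
    refine Disjoint.closure_left (disjoint_iUnion_left.2 fun k ↦ ?_) hV
    exact disjoint_iff_inter_eq_empty.2 (hUV (k + 1) k.succ_pos)
  have hmeas : ∀ x, MeasurableSet (Prod.mk x ⁻¹' N) := fun x ↦
    (hN.preimage (Continuous.prodMk_right x)).measurableSet
  refine ⟨fun x ↦ indicatorConstLp 2 (hmeas x) (measure_ne_top μ _) 1,
    continuous_indicatorConstLp_set (by simp)
      (tendsto_measure_section_symmDiff hmin hμ hN hfN), fun x ↦ ?_, ?_⟩
  · change indicatorConstLp 2 ((hmeas (f x)).preimage hμ.measurable) (measure_ne_top μ _) 1 = _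
    rw [indicatorConstLp_inj _ _ _ _ one_ne_zero]
    refine (ae_eq_of_subset_of_measure_ge (s := Prod.mk x ⁻¹' N)
      (t := f ⁻¹' (Prod.mk (f x) ⁻¹' N)) (fun y hy ↦ hfN x y hy) ?_ (hmeas x).nullMeasurableSet
      (measure_ne_top _ _)).symm
    rw [hμ.measure_preimage (hmeas (f x)).nullMeasurableSet]
    exact (measure_section_eq hmin hμ hN hfN _ _).le
  · by_contra! hconst
    have hae : ∀ x y, Prod.mk x ⁻¹' N =ᵐ[μ] Prod.mk y ⁻¹' N := fun x y ↦
      (indicatorConstLp_inj _ _ _ _ one_ne_zero).1 (hconst x y)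
    obtain ⟨⟨a, b⟩, hab⟩ : O.Nonempty := by
      obtain ⟨u, hu⟩ := hUne
      exact ⟨_, mem_iUnion.2 ⟨0, u, hu, rfl⟩⟩
    obtain ⟨W₁, W, -, hW, haW, hbW, hWO⟩ := isOpen_prod_iff.1 hOo a b hab
    have hWN : ∀ x, ∀ y ∈ W, (x, y) ∈ N := by
      intro x
      have h1 : μ (W \ Prod.mk x ⁻¹' N) = 0 := by
        refine measure_mono_null (sdiff_subset_sdiff_left (s₂ := Prod.mk a ⁻¹' N) fun y hy ↦ ?_)
          (ae_le_set.1 (hae a x).le)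
        exact subset_closure (hWO (mk_mem_prod haW hy))
      have h2 : IsOpen (W \ Prod.mk x ⁻¹' N) := hW.sdiff (hN.preimage (Continuous.prodMk_right x))
      exact sdiff_eq_empty.1 ((h2.measure_eq_zero_iff μ).1 h1)
    obtain ⟨V₁, V₂, -, hV₂, hv₁, hv₂, hVV⟩ := isOpen_prod_iff.1 hV v₁ v₂ hv
    obtain ⟨k, -, _, ⟨w, hw, rfl⟩, hwV⟩ := htt W V₂ hW hV₂ ⟨b, hbW⟩ ⟨v₂, hv₂⟩
    obtain ⟨x, hx⟩ := hf.surjective.iterate k v₁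
    have hk : ∀ k x y, (x, y) ∈ N → (f^[k] x, f^[k] y) ∈ N := fun k ↦ by
      induction k with
      | zero => exact fun _ _ h ↦ h
      | succ k ih => exact fun x y h ↦ ih _ _ (hfN x y h)
    have h3 := hk k x w (hWN x w hw)
    rw [hx] at h3
    exact hNV.le_bot ⟨h3, hVV (mk_mem_prod hv₁ hwV)⟩

theorem Circle.denseRange_zpow {w : Circle} (hw : ∀ n : ℕ, 0 < n → w ^ n ≠ 1) :
    DenseRange (w ^ · : ℤ → Circle) := by
  have : Fact (0 < 2 * Real.pi) := ⟨Real.two_pi_pos⟩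
  obtain ⟨a, rfl⟩ := AddCircle.homeomorphCircle'.surjective w
  have hto : ∀ b, AddCircle.homeomorphCircle' b = AddCircle.toCircle b := fun b ↦ by
    induction b using QuotientAddGroup.induction_on with
    | H x => simp [AddCircle.toCircle_apply_mk, AddCircle.homeomorphCircle'_apply_mk]
  have ha : addOrderOf a = 0 := addOrderOf_eq_zero_iff'.2 fun n hn h ↦ hw n hn (by
    rw [hto, ← AddCircle.toCircle_nsmul, h, AddCircle.toCircle_zero])
  have := AddCircle.homeomorphCircle'.surjective.denseRange.comp
    (AddCircle.denseRange_zsmul_iff.2 ha) AddCircle.homeomorphCircle'.continuous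
  convert this using 1
  ext n
  simp [hto, AddCircle.toCircle_zsmul]

/-- A continuous map to the circle semiconjugating a surjection of a compact space to an irrational
rotation is surjective. -/
theorem surjective_of_semiconj_rotation {X : Type*} [TopologicalSpace X] [CompactSpace X]
    [Nonempty X] {f : X → X} (hf : Function.Surjective f) {h : X → Circle} (hh : Continuous h)
    {w : Circle} (hfh : ∀ x, h (f x) = w * h x) (hw : ∀ n : ℕ, 0 < n → w ^ n ≠ 1) :
    Function.Surjective h := by
  obtain ⟨x₀⟩ := ‹Nonempty X›
  have hz : ∀ n : ℤ, w ^ n * h x₀ ∈ range h := by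
    intro n
    induction n using Int.induction_on with
    | zero => simp
    | succ n ih =>
      obtain ⟨x, hx⟩ := ih
      exact ⟨f x, by rw [hfh, hx, ← mul_assoc, add_comm, zpow_add, zpow_one]⟩
    | pred n ih =>
      obtain ⟨x, hx⟩ := ih
      obtain ⟨y, rfl⟩ := hf x
      refine ⟨y, ?_⟩
      rw [sub_eq_neg_add, zpow_add, zpow_neg_one, mul_assoc, ← hx, hfh, inv_mul_cancel_left]
  have hcl : IsClosed {c : Circle | c * h x₀ ∈ range h} :=
    (isCompact_range hh).isClosed.preimage (continuous_mul_const _)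
  intro c
  have := (Circle.denseRange_zpow hw).induction_on (p := fun c ↦ c * h x₀ ∈ range h)
    (c * (h x₀)⁻¹) hcl hz
  simpa using this

/-- A nonconstant continuous eigenfunction of a minimal totally transitive system gives a
surjective semiconjugacy to a rotation of the unit circle. -/
theorem exists_circle_factor_of_eigenfunction {X : Type*} [TopologicalSpace X] [CompactSpace X]
    {f : X → X} (hf : IsHomeomorph f) (hmin : MinimalSys f) (htt : TotallyTransitive f)
    {g : X → ℂ} {ω : ℂ} (hg : Continuous g) (hω : ‖ω‖ = 1) (hfg : ∀ x, g (f x) = ω * g x)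
    (hne : ∃ x y, g x ≠ g y) :
    ∃ h : X → Circle, Continuous h ∧ Function.Surjective h ∧ ∀ x, (h (f x) : ℂ) = ω * h x := by
  obtain ⟨a, b, hab⟩ := hne
  have : Nonempty X := ⟨a⟩
  have hnorm : ∀ x, ‖g x‖ = ‖g a‖ := fun x ↦
    hmin.apply_eq_of_comp_eq hg.norm (fun x ↦ by rw [hfg, norm_mul, hω, one_mul]) x a
  have hg0 : ∀ x, g x ≠ 0 := fun x hx ↦ by
    have h0 : ∀ y, g y = 0 := fun y ↦ by
      rw [← norm_eq_zero, hnorm y, ← hnorm x, hx, norm_zero]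
    exact hab (by rw [h0, h0])
  have hωn : ∀ n : ℕ, 0 < n → ω ^ n ≠ 1 := fun n hn h1 ↦ by
    have hgn : ∀ n x, g (f^[n] x) = ω ^ n * g x := fun n ↦ by
      induction n with
      | zero => simp
      | succ n ih => intro x; rw [Function.iterate_succ_apply', hfg, ih, pow_succ']; ring
    obtain ⟨P, Q, hP, hQ, haP, hbQ, hPQ⟩ := t2_separation hab
    obtain ⟨k, -, _, ⟨x, hx, rfl⟩, hxQ⟩ := htt n hn _ _ (hP.preimage hg) (hQ.preimage hg)
      ⟨a, haP⟩ ⟨b, hbQ⟩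
    rw [mem_preimage, ← Function.iterate_mul, hgn, pow_mul, h1, one_pow, one_mul] at hxQ
    exact hPQ.le_bot ⟨hx, hxQ⟩
  let w : Circle := ⟨ω, mem_sphere_zero_iff_norm.2 hω⟩
  have hh1 : ∀ x, g x / ‖g a‖ ∈ Submonoid.unitSphere ℂ := fun x ↦ by
    refine mem_sphere_zero_iff_norm.2 ?_
    rw [norm_div, hnorm x, Complex.norm_real, norm_norm, div_self (norm_ne_zero_iff.2 (hg0 a))]
  let h : X → Circle := fun x ↦ ⟨g x / ‖g a‖, hh1 x⟩
  have hhc : Continuous h := Continuous.subtype_mk (hg.div_const _) hh1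
  have hfh : ∀ x, (h (f x) : ℂ) = ω * h x := fun x ↦ by
    change g (f x) / ‖g a‖ = ω * (g x / ‖g a‖)
    rw [hfg, mul_div_assoc]
  refine ⟨h, hhc, surjective_of_semiconj_rotation hf.surjective hhc (w := w)
    (fun x ↦ Circle.ext (hfh x)) fun n hn h1 ↦ hωn n hn ?_, hfh⟩
  have h2 := congrArg ((↑) : Circle → ℂ) h1
  rwa [Circle.coe_pow, Circle.coe_one] at h2

theorem norm_snd_rotCoeff_le {ω : ℂ} (hω : ‖ω‖ = 1) (n : ℕ) {z : ℂ} (hz : ‖z‖ = 1) :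
    ‖(rotCoeff ω n z).2‖ ≤ ‖(rotCoeff ω n z).1‖ := by
  have := normSq_rotCoeff hω n hz
  exact abs_le_of_sq_le_sq' (by linarith) (norm_nonneg _) |>.2

theorem one_le_norm_fst_rotCoeff {ω : ℂ} (hω : ‖ω‖ = 1) (n : ℕ) {z : ℂ} (hz : ‖z‖ = 1) :
    1 ≤ ‖(rotCoeff ω n z).1‖ := by
  have := normSq_rotCoeff hω n hz
  nlinarith [norm_nonneg (rotCoeff ω n z).1, sq_nonneg ‖(rotCoeff ω n z).2‖]

theorem abs_log_sub_log_le {a b : ℝ} (ha : 0 < a) (hb : 0 < b) (hab : a ≤ 2 * b)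
    (hba : b ≤ 2 * a) : |Real.log a - Real.log b| ≤ Real.log 2 := by
  have h1 := Real.log_le_log ha hab
  have h2 := Real.log_le_log hb hba
  rw [Real.log_mul two_ne_zero (by positivity)] at h1 h2
  exact abs_sub_le_iff.2 ⟨by linarith, by linarith⟩

theorem abs_log_rotCoeff_succ_sub_le {ω : ℂ} (hω : ‖ω‖ = 1) (n : ℕ) {z : ℂ} (hz : ‖z‖ = 1) :
    |Real.log ‖(rotCoeff ω (n + 1) z).1‖ - Real.log ‖(rotCoeff ω n (ω * z)).1‖| ≤
      Real.log 2 := by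
  have hωz : ‖ω * z‖ = 1 := by simp [hω, hz]
  have h1 := one_le_norm_fst_rotCoeff hω (n + 1) hz
  have h2 := one_le_norm_fst_rotCoeff hω n hωz
  have h3 := norm_snd_rotCoeff_le hω n hωz
  have e : ‖(rotCoeff ω (n + 1) z).1‖ = ‖5 / 4 * (rotCoeff ω n (ω * z)).1 +
      3 / 4 * (rotCoeff ω n (ω * z)).2‖ := by
    rw [rotCoeff_succ', norm_mul, hz, one_mul]
  have hp : ‖5 / 4 * (rotCoeff ω n (ω * z)).1‖ = 5 / 4 * ‖(rotCoeff ω n (ω * z)).1‖ := by simp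
  have hq : ‖3 / 4 * (rotCoeff ω n (ω * z)).2‖ = 3 / 4 * ‖(rotCoeff ω n (ω * z)).2‖ := by simp
  have h4 := norm_add_le (5 / 4 * (rotCoeff ω n (ω * z)).1) (3 / 4 * (rotCoeff ω n (ω * z)).2)
  have h5 := norm_sub_le_norm_add (5 / 4 * (rotCoeff ω n (ω * z)).1)
    (3 / 4 * (rotCoeff ω n (ω * z)).2)
  refine abs_log_sub_log_le (by linarith) (by linarith) ?_ ?_ <;> linarith

/-- Over a circle factor of a minimal system, the iterates have no uniform growth rate. -/
theorem not_tendstoUniformly_log_rotCoeff {X : Type*} [TopologicalSpace X] {f : X → X}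
    (hmin : MinimalSys f) {h : X → Circle} (hh : Continuous h) (hsurj : Function.Surjective h)
    {ω : ℂ} (hω : ‖ω‖ = 1) (hfh : ∀ x, (h (f x) : ℂ) = ω * h x) (L : X → ℝ) :
    ¬ TendstoUniformly (fun (n : ℕ) x ↦ Real.log ‖(rotCoeff ω n (h x)).1‖ / n) L atTop := by
  intro hL
  have hh1 : ∀ x, ‖(h x : ℂ)‖ = 1 := fun x ↦ Circle.norm_coe _
  have hsurj' : ∀ z : ℂ, ‖z‖ = 1 → ∃ x, (h x : ℂ) = z := fun z hz ↦ by
    obtain ⟨x, hx⟩ := hsurj ⟨z, mem_sphere_zero_iff_norm.2 hz⟩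
    exact ⟨x, congrArg ((↑) : Circle → ℂ) hx⟩
  have h1 : ∀ n x, 1 ≤ ‖(rotCoeff ω n (h x)).1‖ := fun n x ↦
    one_le_norm_fst_rotCoeff hω n (hh1 x)
  have hLc : Continuous L := by
    refine hL.continuous (Frequently.of_forall fun n ↦ Continuous.div_const ?_ _)
    refine Continuous.log ?_ fun x ↦ (zero_lt_one.trans_le (h1 n x)).ne'
    exact ((continuous_rotCoeff ω n).comp (continuous_subtype_val.comp hh)).fst.norm
  have hLf : ∀ x, L (f x) = L x := fun x ↦ by
    have t1 := (hL.tendsto_at x).comp (tendsto_add_atTop_nat 1)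
    have t2 := (hL.tendsto_at (f x)).mul
      (tendsto_natCast_div_add_atTop (1 : ℝ))
    rw [mul_one] at t2
    have t3 : Tendsto (fun n : ℕ ↦ Real.log 2 * (1 / ((n : ℝ) + 1))) atTop (𝓝 0) := by
      simpa using tendsto_one_div_add_atTop_nhds_zero_nat.const_mul (Real.log 2)
    refine (sub_eq_zero.1 (tendsto_nhds_unique (t1.sub t2)
      (squeeze_zero_norm (fun n ↦ ?_) t3))).symm
    rcases n.eq_zero_or_pos with rfl | hn
    · have := abs_log_rotCoeff_succ_sub_le hω 0 (hh1 x)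
      simpa [rotCoeff] using this
    · have hn' : (0 : ℝ) < n := by exact_mod_cast hn
      have := abs_log_rotCoeff_succ_sub_le hω n (hh1 x)
      rw [← hfh] at this
      have e : Real.log ‖(rotCoeff ω (n + 1) (h x)).1‖ / ((n + 1 : ℕ) : ℝ) -
          Real.log ‖(rotCoeff ω n (h (f x))).1‖ / n * (n / (n + 1)) =
          (Real.log ‖(rotCoeff ω (n + 1) (h x)).1‖ - Real.log ‖(rotCoeff ω n (h (f x))).1‖) *
            (1 / (n + 1)) := by
        push_cast; field_simp
      simp only [Function.comp_apply]
      rw [e, norm_mul, Real.norm_eq_abs, Real.norm_of_nonneg (by positivity)]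
      gcongr
  obtain ⟨x₀, -⟩ := hsurj' 1 norm_one
  have hLconst : ∀ x, L x = L x₀ := fun x ↦ hmin.apply_eq_of_comp_eq hLc hLf x x₀
  set δ : ℝ := Real.log (5 / 4)
  have hδ : 0 < δ := Real.log_pos (by norm_num)
  obtain ⟨n, hn, hn3⟩ := ((Metric.tendstoUniformly_iff.1 hL (δ / 4) (by positivity)).and
    (eventually_ge_atTop 3)).exists
  have hn0 : (3 : ℝ) ≤ n := by exact_mod_cast hn3
  have hub : ∀ x, Real.log ‖(rotCoeff ω n (h x)).1‖ ≤ n * (L x₀ + δ / 4) ∧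
      n * (L x₀ - δ / 4) ≤ Real.log ‖(rotCoeff ω n (h x)).1‖ := fun x ↦ by
    have := hn x
    rw [hLconst, Real.dist_eq, abs_lt] at this
    have e : Real.log ‖(rotCoeff ω n (h x)).1‖ =
      n * (Real.log ‖(rotCoeff ω n (h x)).1‖ / n) := by field_simp
    rw [e]
    constructor <;> gcongr <;> linarith
  have hlow : n * δ ≤ n * (L x₀ + δ / 4) := by
    rw [← Real.log_pow, Real.log_le_iff_le_exp (by positivity)]
    refine pow_le_of_norm_rotCoeff_le hω n fun z hz ↦ ?_
    obtain ⟨x, rfl⟩ := hsurj' z hz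
    exact (Real.log_le_iff_le_exp (zero_lt_one.trans_le (h1 n x))).1 (hub x).1
  obtain ⟨z, hz, hzle⟩ := exists_norm_rotCoeff_le hω n
  obtain ⟨x, rfl⟩ := hsurj' z hz
  have hup := (hub x).2.trans (Real.log_le_log (zero_lt_one.trans_le (h1 n x)) hzle)
  change _ ≤ δ at hup
  nlinarith

/-- The matrix of the real-linear map `w ↦ p w + q (conj w)` of `ℂ`. -/
def conjLinMatrix (c : ℂ × ℂ) : Matrix (Fin 2) (Fin 2) ℝ :=
  !![c.1.re + c.2.re, c.2.im - c.1.im; c.1.im + c.2.im, c.1.re - c.2.re]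

theorem conjLinMatrix_mul (c d : ℂ × ℂ) : conjLinMatrix c * conjLinMatrix d =
    conjLinMatrix (c.1 * d.1 + c.2 * conj d.2, c.1 * d.2 + c.2 * conj d.1) := by
  ext i j
  fin_cases i <;> fin_cases j <;> simp [conjLinMatrix, Matrix.mul_apply] <;> ring

theorem det_conjLinMatrix (c : ℂ × ℂ) : (conjLinMatrix c).det = ‖c.1‖ ^ 2 - ‖c.2‖ ^ 2 := by
  rw [conjLinMatrix, Matrix.det_fin_two_of, ← Complex.normSq_eq_norm_sq,
    ← Complex.normSq_eq_norm_sq, Complex.normSq_apply, Complex.normSq_apply]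
  ring

theorem continuous_conjLinMatrix : Continuous conjLinMatrix := by
  refine continuous_matrix fun i j ↦ ?_
  fin_cases i <;> fin_cases j <;> simp [conjLinMatrix] <;> fun_prop

theorem norm_fst_le_conjLinMatrix (c : ℂ × ℂ) : ‖c.1‖ ≤ 2 * ‖conjLinMatrix c‖ := by
  have h := fun i j ↦ abs_le.1 (Matrix.norm_entry_le_entrywise_sup_norm (conjLinMatrix c)
    (i := i) (j := j))
  have h00 := h 0 0
  have h01 := h 0 1
  have h10 := h 1 0
  have h11 := h 1 1
  simp only [conjLinMatrix, Matrix.of_apply, Matrix.cons_val', Matrix.cons_val_zero,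
    Matrix.cons_val_one, Matrix.cons_val_fin_one] at h00 h01 h10 h11
  have hre : |c.1.re| ≤ ‖conjLinMatrix c‖ := abs_le.2 ⟨by
    simp only [conjLinMatrix]; linarith, by simp only [conjLinMatrix]; linarith⟩
  have him : |c.1.im| ≤ ‖conjLinMatrix c‖ := abs_le.2 ⟨by
    simp only [conjLinMatrix]; linarith, by simp only [conjLinMatrix]; linarith⟩
  linarith [Complex.norm_le_abs_re_add_abs_im c.1]

theorem norm_conjLinMatrix_le (c : ℂ × ℂ) : ‖conjLinMatrix c‖ ≤ ‖c.1‖ + ‖c.2‖ := by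
  have h1 := abs_le.1 (Complex.abs_re_le_norm c.1)
  have h2 := abs_le.1 (Complex.abs_im_le_norm c.1)
  have h3 := abs_le.1 (Complex.abs_re_le_norm c.2)
  have h4 := abs_le.1 (Complex.abs_im_le_norm c.2)
  refine (Matrix.norm_le_iff (by positivity)).2 fun i j ↦ abs_le.2 ?_
  fin_cases i <;> fin_cases j <;> simp [conjLinMatrix] <;> constructor <;> linarith

/-- The block matrix `diag(M, 1)`. -/
def blockEmb (k : ℕ) (M : Matrix (Fin 2) (Fin 2) ℝ) : Matrix (Fin (2 + k)) (Fin (2 + k)) ℝ :=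
  (Matrix.fromBlocks M 0 0 1).submatrix finSumFinEquiv.symm finSumFinEquiv.symm

theorem blockEmb_mul (k : ℕ) (M N : Matrix (Fin 2) (Fin 2) ℝ) :
    blockEmb k M * blockEmb k N = blockEmb k (M * N) := by
  simp [blockEmb, Matrix.submatrix_mul_equiv, Matrix.fromBlocks_multiply]

theorem blockEmb_one (k : ℕ) : blockEmb k 1 = 1 := by
  simp [blockEmb]

theorem det_blockEmb (k : ℕ) (M : Matrix (Fin 2) (Fin 2) ℝ) : (blockEmb k M).det = M.det := by
  simp [blockEmb]

theorem continuous_blockEmb (k : ℕ) : Continuous (blockEmb k) :=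
  (Continuous.matrix_fromBlocks continuous_id continuous_const continuous_const
    continuous_const).matrix_submatrix _ _

theorem norm_le_norm_blockEmb (k : ℕ) (M : Matrix (Fin 2) (Fin 2) ℝ) : ‖M‖ ≤ ‖blockEmb k M‖ := by
  refine (Matrix.norm_le_iff (norm_nonneg _)).2 fun i j ↦ ?_
  have := Matrix.norm_entry_le_entrywise_sup_norm (blockEmb k M)
    (i := finSumFinEquiv (Sum.inl i)) (j := finSumFinEquiv (Sum.inl j))
  simpa only [blockEmb, Matrix.submatrix_apply, Equiv.symm_apply_apply,
    Matrix.fromBlocks_apply₁₁] using this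

theorem norm_blockEmb_le (k : ℕ) (M : Matrix (Fin 2) (Fin 2) ℝ) :
    ‖blockEmb k M‖ ≤ max ‖M‖ 1 := by
  refine (Matrix.norm_le_iff (by positivity)).2 fun i j ↦ ?_
  rw [blockEmb, Matrix.submatrix_apply]
  rcases finSumFinEquiv.symm i with i | i <;> rcases finSumFinEquiv.symm j with j | j
  · exact (Matrix.norm_entry_le_entrywise_sup_norm M).trans (le_max_left _ _)
  · simp
  · simp
  · rw [Matrix.fromBlocks_apply₂₂, Matrix.one_apply]
    split_ifs <;> simp

/-- The cocycle generated over a circle factor by `diag(2, 1/2)` composed with a rotation. -/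
theorem cocycle_blockEmb {X : Type*} {f : X → X} {h : X → ℂ} {ω : ℂ}
    (hfh : ∀ x, h (f x) = ω * h x) (k n : ℕ) (x : X) :
    cocycle f (fun x ↦ blockEmb k (conjLinMatrix (5 / 4 * h x, 3 / 4 * conj (h x)))) n x =
      blockEmb k (conjLinMatrix (rotCoeff ω n (h x))) := by
  have hfn : ∀ n, h (f^[n] x) = ω ^ n * h x := fun n ↦ by
    induction n with
    | zero => simp
    | succ n ih => rw [Function.iterate_succ_apply', hfh, ih, pow_succ']; ring
  induction n with
  | zero =>
    have : conjLinMatrix (1, 0) = 1 := by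
      ext i j
      fin_cases i <;> fin_cases j <;> simp [conjLinMatrix]
    rw [cocycle, rotCoeff, this, blockEmb_one]
  | succ n ih =>
    rw [cocycle, ih, blockEmb_mul, conjLinMatrix_mul, hfn, rotCoeff]

theorem abs_log_norm_blockEmb_sub_le {ω : ℂ} (hω : ‖ω‖ = 1) (k n : ℕ) {z : ℂ} (hz : ‖z‖ = 1) :
    |Real.log ‖blockEmb k (conjLinMatrix (rotCoeff ω n z))‖ - Real.log ‖(rotCoeff ω n z).1‖| ≤
      Real.log 2 := by
  have h1 := one_le_norm_fst_rotCoeff hω n hz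
  have h2 := norm_snd_rotCoeff_le hω n hz
  have h3 := norm_fst_le_conjLinMatrix (rotCoeff ω n z)
  have h4 := norm_conjLinMatrix_le (rotCoeff ω n z)
  have h5 := norm_le_norm_blockEmb k (conjLinMatrix (rotCoeff ω n z))
  have h6 := norm_blockEmb_le k (conjLinMatrix (rotCoeff ω n z))
  refine abs_log_sub_log_le (by linarith) (by linarith) (h6.trans (max_le ?_ ?_)) ?_ <;> linarith

/-- Theorem B: a uniquely ergodic, minimal, totally transitive but not topologically weakly
mixing dynamical system admits a non-uniform continuous `GL(m,ℝ)`-cocycle for every `m ≥ 2`. -/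
theorem exists_nonuniform_cocycle_of_not_topWeaklyMixing
    {X : Type*} [MetricSpace X] [CompactSpace X] [MeasurableSpace X] [BorelSpace X]
    (f : X → X) (hf : IsHomeomorph f) (hue : UniquelyErgodic f) (hmin : MinimalSys f)
    (htt : TotallyTransitive f) (hwm : ¬ TopWeaklyMixing f)
    (m : ℕ) (hm : 2 ≤ m) :
    ∃ A : X → Matrix (Fin m) (Fin m) ℝ, ContGL A ∧ ¬ IsUniformCocycle f A := by
  obtain ⟨μ, ⟨hprob, hmap⟩, -⟩ := hue
  have hμ : MeasurePreserving f μ μ := ⟨hf.continuous.measurable, hmap⟩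
  have := hmin.isOpenPosMeasure hμ
  obtain ⟨φ, hφ, hV, hne⟩ := exists_equivariant_of_not_topWeaklyMixing hf hμ hmin
    (htt 1 one_pos) hwm
  obtain ⟨g, ω, hg, hω, hfg, hne⟩ := exists_eigenfunction_of_equivariant
    hf.isClosedEmbedding.measurableEmbedding hμ hφ _ hV hne
  obtain ⟨h, hh, hsurj, hfh⟩ := exists_circle_factor_of_eigenfunction hf hmin htt hg hω hfg hne
  obtain ⟨k, rfl⟩ := Nat.exists_eq_add_of_le hm
  have hh1 : ∀ x, ‖(h x : ℂ)‖ = 1 := fun x ↦ Circle.norm_coe _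
  have hhc : Continuous fun x ↦ (h x : ℂ) := continuous_subtype_val.comp hh
  refine ⟨fun x ↦ blockEmb k (conjLinMatrix (5 / 4 * h x, 3 / 4 * conj (h x : ℂ))),
    ⟨(continuous_blockEmb k).comp (continuous_conjLinMatrix.comp (by fun_prop)), fun x ↦ ?_⟩, ?_⟩
  · rw [Matrix.isUnit_iff_isUnit_det, det_blockEmb, det_conjLinMatrix]
    norm_num [hh1]
  · rintro ⟨L, hL⟩
    refine not_tendstoUniformly_log_rotCoeff hmin hh hsurj hω hfh L ?_
    rw [Metric.tendstoUniformly_iff] at hL ⊢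
    intro ε hε
    have hlim := (tendsto_const_div_atTop_nhds_zero_nat (Real.log 2)).eventually_lt_const
      (half_pos hε)
    filter_upwards [hL _ (half_pos hε), hlim] with n hn hn2 x
    refine (dist_triangle _ _ _).trans_lt (add_halves ε ▸ add_lt_add (hn x) (lt_of_le_of_lt ?_ hn2))
    rw [cocycle_blockEmb (h := fun x ↦ (h x : ℂ)) hfh, Real.dist_eq, ← sub_div, abs_div,
      Nat.abs_cast]
    gcongr
    exact abs_log_norm_blockEmb_sub_le hω k n (hh1 x)
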